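/- Let k ⊆ K ⊆ L be field extensions with [L:K] < ∞, and let K^sep denote the separable closure of K in L (the set of elements of L separable over K). Then ed_k(K^sep/K) ≤ ed_k(L/K) and ed_k(L/K^sep) ≤ ed_k(L/K). -/

import Mathlib

open scoped TensorProduct

universe u

/-- The transcendence degree of `E` over `k`, as a cardinal: the supremum of the cardinalities
of algebraically independent subsets of `E`. -/
noncomputable def trdeg (k E : Type u) [CommRing k] [CommRing E] [Algebra k E] : Cardinal :=
  ⨆ s : {s : Set E // AlgebraicIndependent k ((↑) : s → E)}, Cardinal.mk s.1

/-- The `K`-algebra `A` descends to the intermediate field `K₀` of `K/k`: there is a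
`K₀`-algebra `A₀` with `A ≅ A₀ ⊗_{K₀} K` as `K`-algebras. -/
def Descends (k : Type u) {K : Type u} (A : Type u) [Field k] [Field K] [Algebra k K]
    [Ring A] [Algebra K A] (K₀ : IntermediateField k K) : Prop :=
  ∃ (A₀ : Type u) (_ : Ring A₀) (_ : Algebra K₀ A₀),
    Nonempty ((K ⊗[K₀] A₀) ≃ₐ[K] A)

/-- The essential dimension `ed k K A` of a `K`-algebra `A` over the base field `k ⊆ K`:
the minimum of `trdeg k K₀` over all intermediate fields `k ⊆ K₀ ⊆ K` to which `A`
descends. -/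
noncomputable def ed (k K A : Type u) [Field k] [Field K] [Algebra k K]
    [Ring A] [Algebra K A] : Cardinal :=
  ⨅ K₀ : {K₀ : IntermediateField k K // Descends k A K₀}, trdeg k K₀.1

/-- A commutative square of algebras is a pushout if the multiplication map `S ⊗[R] R' → S'` is
bijective. -/
theorem isPushout_of_bijective_lift {R S R' S' : Type*} [CommRing R] [CommRing S] [CommRing R']
    [CommRing S'] [Algebra R S] [Algebra R R'] [Algebra R S'] [Algebra S S'] [Algebra R' S']
    [IsScalarTower R S S'] [IsScalarTower R R' S']
    (h : Function.Bijective (Algebra.TensorProduct.lift (Algebra.ofId S S')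
      (IsScalarTower.toAlgHom R R' S') fun _ _ ↦ Commute.all _ _)) :
    Algebra.IsPushout R S R' S' where
  out := .of_equiv (AlgEquiv.ofBijective _ h).toLinearEquiv fun x ↦ by simp

/-- If `L ≅ K ⊗[F] A₀` is a finite field extension of `K`, then `A₀` can be taken to be a subfield
of `L`. -/
theorem exists_isPushout_of_algEquiv {F K L A₀ : Type*} [Field F] [Field K] [Field L]
    [Algebra F K] [Algebra K L] [Algebra F L] [IsScalarTower F K L] [FiniteDimensional K L]
    [Ring A₀] [Algebra F A₀] (e : (K ⊗[F] A₀) ≃ₐ[K] L) :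
    ∃ L₀ : IntermediateField F L, Algebra.IsAlgebraic F L₀ ∧ Algebra.IsPushout F K L₀ L := by
  have : Module.Finite K (K ⊗[F] A₀) := Module.Finite.equiv e.symm.toLinearEquiv
  have : Module.Finite F A₀ := Module.Finite.of_finite_tensorProduct_of_faithfullyFlat K
  let f : A₀ →ₐ[F] L := (e.toAlgHom.restrictScalars F).comp Algebra.TensorProduct.includeRight
  have hf : Function.Injective f := e.injective.comp
    (Algebra.TensorProduct.includeRight_injective (algebraMap F K).injective)
  let g : A₀ ≃ₐ[F] f.range := AlgEquiv.ofInjective f hf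
  have : Module.Finite F f.range := Module.Finite.equiv g.toLinearEquiv
  let L₀ : IntermediateField F L := Algebra.IsAlgebraic.toIntermediateField f.range
  let g' : A₀ ≃ₐ[F] L₀ := g
  refine ⟨L₀, inferInstanceAs (Algebra.IsAlgebraic F f.range), ?_⟩
  refine ⟨.of_equiv ((TensorProduct.AlgebraTensorModule.congr (.refl K K)
    g'.symm.toLinearEquiv).trans e.toLinearEquiv) fun x ↦ ?_⟩
  obtain ⟨y, rfl⟩ := g'.surjective x
  simp
  rfl

section Pushout

variable {F K L M L₀ : Type*} [Field F] [Field K] [Field L] [Field M] [Field L₀]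
  [Algebra F K] [Algebra K L] [Algebra F L] [IsScalarTower F K L]
  [Algebra F M] [Algebra F L₀] [Algebra M L₀] [IsScalarTower F M L₀]
  [Algebra L₀ L] [IsScalarTower F L₀ L]
  [Algebra M (separableClosure K L)] [Algebra M L]
  [IsScalarTower M (separableClosure K L) L] [IsScalarTower M L₀ L]
  [IsScalarTower F M (separableClosure K L)]
  [Algebra.IsAlgebraic K L] [IsPurelyInseparable M L₀]
  [Algebra.IsPushout F K L₀ L]

variable (F K L M L₀)

include L₀ in
/-- Suppose `L = K ⊗[F] L₀`, and `M ⊆ L₀` is contained in the separable closure of `K` in `L` with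
`L₀ / M` purely inseparable. Then the separable closure of `K` in `L` is `K ⊗[F] M`. -/
theorem isPushout_separableClosure : Algebra.IsPushout F K M (separableClosure K L) := by
  set φ := Algebra.TensorProduct.lift (Algebra.ofId K (separableClosure K L))
    (IsScalarTower.toAlgHom F M (separableClosure K L)) fun _ _ ↦ Commute.all _ _ with hφ
  set ψ : (K ⊗[F] M) →ₐ[K] L := (separableClosure K L).val.comp φ with hψ
  have hML (m : M) : ((algebraMap M (separableClosure K L) m : separableClosure K L) : L) =
      algebraMap L₀ L (algebraMap M L₀ m) := by
    rw [← IsScalarTower.algebraMap_apply M L₀ L,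
      IsScalarTower.algebraMap_apply M (separableClosure K L) L]
    rfl
  apply isPushout_of_bijective_lift
  rw [← hφ]
  constructor
  · have h1 : (⇑ψ) = Algebra.IsPushout.equiv F K L₀ L ∘
        (IsScalarTower.toAlgHom F M L₀).toLinearMap.lTensor K := by
      ext x
      induction x with
      | zero => simp
      | add x y hx hy => simp only [map_add, hx, hy, Function.comp_apply]
      | tmul a b => simp [hψ, hφ, hML, Algebra.IsPushout.equiv_tmul, Algebra.ofId_apply]
    have h2 : Function.Injective ψ := by
      rw [h1]
      exact (Algebra.IsPushout.equiv F K L₀ L).injective.comp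
        (Module.Flat.lTensor_preserves_injective_linearMap _ (algebraMap M L₀).injective)
    exact Function.Injective.of_comp (f := Subtype.val) h2
  · let R : IntermediateField K L := subalgebraEquivIntermediateField ψ.range
    have hR (x : K ⊗[F] M) : ψ x ∈ R := ⟨x, rfl⟩
    have hL₀ (l : L₀) : algebraMap L₀ L l ∈ perfectClosure R L := by
      have : ExpChar F (ringExpChar F) := inferInstance
      have : ExpChar R (ringExpChar F) :=
        expChar_of_injective_algebraMap (algebraMap F R).injective _
      have : ExpChar M (ringExpChar F) :=
        expChar_of_injective_algebraMap (algebraMap F M).injective _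
      obtain ⟨n, m, hm⟩ := IsPurelyInseparable.pow_mem M (ringExpChar F) l
      rw [mem_perfectClosure_iff_pow_mem (ringExpChar F)]
      refine ⟨n, ⟨ψ (1 ⊗ₜ m), hR _⟩, ?_⟩
      rw [← map_pow, ← hm, ← hML]
      simp [hψ, hφ]
    have hpi : IsPurelyInseparable R L := by
      rw [isPurelyInseparable_iff_perfectClosure_eq_top, eq_top_iff]
      rintro y -
      obtain ⟨x, rfl⟩ := (Algebra.IsPushout.equiv F K L₀ L).surjective y
      induction x with
      | zero => simp
      | add x y hx hy => rw [map_add]; exact add_mem hx hy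
      | tmul a b =>
        rw [Algebra.IsPushout.equiv_tmul, IsScalarTower.algebraMap_apply K R L]
        exact mul_mem (algebraMap_mem _ _) (hL₀ b)
    intro s
    obtain ⟨x, hx⟩ := separableClosure_le K L R s.2
    exact ⟨x, Subtype.ext hx⟩

include F in
/-- Suppose `L = K ⊗[F] L₀`, and `M ⊆ L₀` is contained in the separable closure `S` of `K` in `L`
with `L₀ / M` purely inseparable. Then `L = S ⊗[M] L₀`. -/
theorem isPushout_over_separableClosure : Algebra.IsPushout M (separableClosure K L) L₀ L := by
  have : IsScalarTower F (separableClosure K L) L := .of_algebraMap_eq fun _ ↦ rfl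
  have := isPushout_separableClosure F K L M L₀
  have h1 : Algebra.IsPushout F M K (separableClosure K L) := this.symm
  have h2 : Algebra.IsPushout F L₀ K L := .symm inferInstance
  exact ((Algebra.IsPushout.comp_iff F M K (separableClosure K L) (T := L₀) (T' := L)).mp h2).symm

end Pushout

theorem trdeg_eq_algebraTrdeg (k E : Type u) [CommRing k] [CommRing E] [Algebra k E] :
    trdeg k E = Algebra.trdeg k E := rfl

theorem ed_le_of_descends {k K A : Type u} [Field k] [Field K] [Algebra k K]
    [Ring A] [Algebra K A] {K₀ : IntermediateField k K} (h : Descends k A K₀) :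
    ed k K A ≤ trdeg k K₀ :=
  ciInf_le' (fun K₀ : {K₀ : IntermediateField k K // Descends k A K₀} ↦ trdeg k K₀.1) ⟨K₀, h⟩

theorem descends_top (k K A : Type u) [Field k] [Field K] [Algebra k K]
    [Ring A] [Algebra K A] : Descends k A (⊤ : IntermediateField k K) := by
  let φ : (K ⊗[(⊤ : IntermediateField k K)] A) →ₐ[K] A :=
    Algebra.TensorProduct.lift (Algebra.ofId K A) (AlgHom.id _ A)
      fun x y ↦ Algebra.commutes x y
  have hφ (a : A) : φ (1 ⊗ₜ a) = a := 
    (Algebra.TensorProduct.lift_tmul _ _ _ _ _).trans (by simp)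
  have hx (x : K ⊗[(⊤ : IntermediateField k K)] A) : ∃ a : A, 1 ⊗ₜ a = x := by
    induction x with
    | zero => exact ⟨0, TensorProduct.tmul_zero _ _⟩
    | add x y hx hy =>
      obtain ⟨a, rfl⟩ := hx
      obtain ⟨b, rfl⟩ := hy
      exact ⟨a + b, TensorProduct.tmul_add _ _ _⟩
    | tmul c a =>
      refine ⟨(⟨c, IntermediateField.mem_top⟩ : (⊤ : IntermediateField k K)) • a, ?_⟩
      rw [← TensorProduct.smul_tmul, Algebra.smul_def, mul_one]
      rfl
  refine ⟨A, inferInstance, inferInstance, ⟨AlgEquiv.ofBijective φ ⟨?_, fun a ↦ ⟨_, hφ a⟩⟩⟩⟩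
  intro x y hxy
  obtain ⟨a, rfl⟩ := hx x
  obtain ⟨b, rfl⟩ := hx y
  rw [hφ, hφ] at hxy
  rw [hxy]

/-- If `L` descends to an `F`-form `L₀`, then the separable closure `S` of `K` in `L` descends to
`F`, and `L` as an `S`-algebra descends to a subfield of `S` that is algebraic over `F`. -/
theorem exists_descends_of_isPushout (k F K L L₀ : Type u) [Field k] [Field F] [Field K] [Field L]
    [Field L₀] [Algebra k F] [Algebra k K] [Algebra k L] [Algebra F K] [Algebra F L] [Algebra F L₀]
    [Algebra K L] [Algebra L₀ L] [IsScalarTower k F K] [IsScalarTower k K L]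
    [IsScalarTower F K L] [IsScalarTower F L₀ L] [Algebra.IsAlgebraic K L]
    [Algebra.IsAlgebraic F L₀] [Algebra.IsPushout F K L₀ L] :
    ∃ M : IntermediateField k (separableClosure K L), trdeg k M ≤ trdeg k F ∧ Descends k L M ∧
      ∃ _ : Algebra F M, Nonempty ((K ⊗[F] M) ≃ₐ[K] separableClosure K L) := by
  let S := separableClosure K L
  have : IsScalarTower F S L := .of_algebraMap_eq fun _ ↦ rfl
  let i : S →ₐ[F] L := IsScalarTower.toAlgHom F S L
  let f : L₀ →ₐ[F] L := IsScalarTower.toAlgHom F L₀ L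
  let M' : IntermediateField F S := separableClosure F S ⊓ f.fieldRange.comap i
  have : IsScalarTower k F S := .of_algebraMap_eq fun x ↦ Subtype.ext <| by
    change algebraMap k L x = algebraMap F L (algebraMap k F x)
    rw [IsScalarTower.algebraMap_apply k K L, IsScalarTower.algebraMap_apply k F K,
      ← IsScalarTower.algebraMap_apply F K L]
  let M : IntermediateField k S := M'.restrictScalars k
  let : Algebra F M := ((algebraMap F S).codRestrict M.toSubring M'.algebraMap_mem).toAlgebra
  have : IsScalarTower F M S := .of_algebraMap_eq fun _ ↦ rfl
  have : IsScalarTower k F M := .of_algebraMap_eq fun x ↦ Subtype.ext <|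
    IsScalarTower.algebraMap_apply k F S x
  let g : L₀ ≃+* f.fieldRange := (AlgEquiv.ofInjectiveField f).toRingEquiv
  let j : M →+* L₀ := g.symm.toRingHom.comp <|
    (i.toRingHom.comp (algebraMap M S)).codRestrict f.fieldRange.toSubring fun x ↦ x.2.2
  have hj (x : M) : algebraMap L₀ L (j x) = ((x : S) : L) :=
    congrArg Subtype.val (g.apply_symm_apply _)
  let : Algebra M L₀ := j.toAlgebra
  have : IsScalarTower M L₀ L := .of_algebraMap_eq fun x ↦ (hj x).symm
  have : IsScalarTower F M L₀ := .of_algebraMap_eq fun x ↦ (algebraMap L₀ L).injective <| by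
    rw [← IsScalarTower.algebraMap_apply F L₀ L]
    exact (hj (algebraMap F M x)).symm
  have : Algebra.IsSeparable F M := by
    refine ⟨fun x ↦ ?_⟩
    rw [← isSeparable_map_iff (IsScalarTower.toAlgHom F M S) (algebraMap M S).injective]
    exact mem_separableClosure_iff.mp x.2.1
  have : IsPurelyInseparable M L₀ := by
    have : ExpChar M (ringExpChar F) :=
      expChar_of_injective_algebraMap (algebraMap F M).injective _
    have : ExpChar (separableClosure F L₀) (ringExpChar F) :=
      expChar_of_injective_algebraMap (algebraMap F _).injective _
    rw [isPurelyInseparable_iff_pow_mem M (ringExpChar F)]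
    intro x
    obtain ⟨n, y, hy⟩ :=
      IsPurelyInseparable.pow_mem (separableClosure F L₀) (ringExpChar F) x
    have hsep : IsSeparable F (f y) := (mem_separableClosure_iff.mp y.2).map f f.injective
    let s : S := ⟨f y, mem_separableClosure_iff.mpr (hsep.tower_top K)⟩
    have hs : s ∈ M' :=
      ⟨mem_separableClosure_iff.mpr ((isSeparable_map_iff i i.injective).mp hsep), y, rfl⟩
    exact ⟨n, ⟨s, hs⟩, ((algebraMap L₀ L).injective (hj _)).trans hy⟩
  have h1 : Algebra.IsPushout F K M S := isPushout_separableClosure F K L M L₀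
  have h2 : Algebra.IsPushout M S L₀ L := isPushout_over_separableClosure F K L M L₀
  refine ⟨M, ?_, ⟨L₀, inferInstance, inferInstance, ⟨h2.equiv M S L₀ L⟩⟩, inferInstance,
    ⟨h1.equiv F K M S⟩⟩
  rw [trdeg_eq_algebraTrdeg, trdeg_eq_algebraTrdeg, ← trdeg_add_eq k F (A := M),
    trdeg_eq_zero (R := F), add_zero]

/-- For `k ⊆ K ⊆ L` with `[L:K] < ∞` and `Kˢᵉᵖ` the separable closure of `K`
in `L`, both `ed_k(Kˢᵉᵖ/K) ≤ ed_k(L/K)` and `ed_k(L/Kˢᵉᵖ) ≤ ed_k(L/K)`. -/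
theorem statement_3 (k K L : Type u) [Field k] [Field K] [Field L]
    [Algebra k K] [Algebra K L] [Algebra k L] [IsScalarTower k K L]
    [FiniteDimensional K L] :
    ed k K (separableClosure K L) ≤ ed k K L ∧
    ed k (separableClosure K L) L ≤ ed k K L := by
  have : Nonempty {K₀ : IntermediateField k K // Descends k L K₀} := ⟨⊤, descends_top k K L⟩
  suffices h : ∀ K₀ : IntermediateField k K, Descends k L K₀ →
      ed k K (separableClosure K L) ≤ trdeg k K₀ ∧
      ed k (separableClosure K L) L ≤ trdeg k K₀ from
    ⟨le_ciInf fun K₀ ↦ (h K₀.1 K₀.2).1, le_ciInf fun K₀ ↦ (h K₀.1 K₀.2).2⟩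
  rintro K₀ ⟨A₀, _, _, ⟨e⟩⟩
  obtain ⟨L₀, _, _⟩ := exists_isPushout_of_algEquiv e
  obtain ⟨M, hM, hL, _, ⟨e'⟩⟩ := exists_descends_of_isPushout k K₀ K L L₀
  exact ⟨ed_le_of_descends ⟨M, inferInstance, inferInstance, ⟨e'⟩⟩,
    (ed_le_of_descends hL).trans hM⟩
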